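/- arXiv:1804.10285 — 2 statements merged into one kernel-verified Lean document; each statement's English description precedes it below -/
import Mathlib

section
/- The base logic is sound and strongly complete with respect to the class of all neighbourhood models with pointwise intersection: for every set of formulas Γ and every formula φ of 𝔏, Γ ⊢ φ in the base logic if and only if Γ ⊨ φ over the class of all models. -/
attribute [local instance] Classical.propDecidable

/-- Formulas of the multi-modal language 𝔏: atoms, ⊥, ¬, ∨, and □_G for
finite nonempty G ⊆ I. -/
inductive Form (I : Type) : Type
  | atom : ℕ → Form I
  | bot  : Form I
  | neg  : Form I → Form I
  | or   : Form I → Form I → Form I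
  | box  : (G : Finset I) → G.Nonempty → Form I → Form I

namespace Form
variable {I : Type}
/-- φ ∧ ψ -/
def and (φ ψ : Form I) : Form I := .neg (.or (.neg φ) (.neg ψ))
/-- φ → ψ -/
def imp (φ ψ : Form I) : Form I := .or (.neg φ) ψ
/-- ⊤ -/
def top : Form I := .neg .bot
/-- φ ↔ ψ -/
def iff (φ ψ : Form I) : Form I := (φ.imp ψ).and (ψ.imp φ)
end Form

/-- The pointwise-intersection neighbourhood function:
`N_G(w) = { ⋂_{i∈G} X_i : X_i ∈ N_i(w) }`. -/
def ptwInter {I W : Type} (N : I → W → Set (Set W)) (G : Finset I) (w : W) :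
    Set (Set W) :=
  { X | ∃ Y : I → Set W, (∀ i ∈ G, Y i ∈ N i w) ∧ X = ⋂ i ∈ G, Y i }

/-- Satisfaction at a world, relative to neighbourhood functions `N` and a
valuation `V`. -/
def satN {I W : Type} (N : I → W → Set (Set W)) (V : ℕ → Set W) :
    Form I → W → Prop
  | .atom n, w => w ∈ V n
  | .bot, _ => False
  | .neg φ, w => ¬ satN N V φ w
  | .or φ ψ, w => satN N V φ w ∨ satN N V ψ w
  | .box G _ φ, w => { v | satN N V φ v } ∈ ptwInter N G w

/-- A neighbourhood model. -/
structure NbhModel (I : Type) where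
  W : Type
  ne : Nonempty W
  N : I → W → Set (Set W)
  V : ℕ → Set W

/-- Truth in a model. -/
def NbhModel.sat {I : Type} (M : NbhModel I) (w : M.W) (φ : Form I) : Prop :=
  satN M.N M.V φ w

/-- Propositional evaluation treating atoms and boxed formulas as atomic. -/
def evalP {I : Type} (v : Form I → Prop) : Form I → Prop
  | .atom n => v (.atom n)
  | .bot => False
  | .neg φ => ¬ evalP v φ
  | .or φ ψ => evalP v φ ∨ evalP v ψ
  | .box G h φ => v (.box G h φ)

/-- Classical propositional tautologies (in the extended modal language). -/
def Tautology {I : Type} (φ : Form I) : Prop := ∀ v, evalP v φ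

theorem unionNE {I : Type} [DecidableEq I] {G H : Finset I}
    (hG : G.Nonempty) : (G ∪ H).Nonempty :=
  hG.mono Finset.subset_union_left

/-- Axiom schema B1: `(□_Gφ ∧ □_Hψ) → □_{G∪H}(φ∧ψ)` for disjoint G, H. -/
def B1Ax (I : Type) [DecidableEq I] : Set (Form I) :=
  { χ | ∃ (G H : Finset I) (hG : G.Nonempty) (hH : H.Nonempty) (φ ψ : Form I),
      Disjoint G H ∧
      χ = ((Form.box G hG φ).and (Form.box H hH ψ)).imp
            (Form.box (G ∪ H) (unionNE hG) (φ.and ψ)) }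

/-- Axiom schema B2: `□_{G∪H}⊤ → □_G⊤`. -/
def B2Ax (I : Type) [DecidableEq I] : Set (Form I) :=
  { χ | ∃ (G H : Finset I) (hG : G.Nonempty) (_hH : H.Nonempty),
      χ = (Form.box (G ∪ H) (unionNE hG) Form.top).imp (Form.box G hG Form.top) }

/-- Axiom schema B3: `(□_Gφ ∧ □_{G∪H∪J}φ) → □_{G∪H}φ`. -/
def B3Ax (I : Type) [DecidableEq I] : Set (Form I) :=
  { χ | ∃ (G H J : Finset I) (hG : G.Nonempty) (_hH : H.Nonempty)
      (_hJ : J.Nonempty) (φ : Form I),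
      χ = ((Form.box G hG φ).and (Form.box (G ∪ H ∪ J) (unionNE (unionNE hG)) φ)).imp
            (Form.box (G ∪ H) (unionNE hG) φ) }

/-- Axiom schema B4: `(□_Gφ ∧ □_H(φ∨ψ)) → □_{G∪H}φ`. -/
def B4Ax (I : Type) [DecidableEq I] : Set (Form I) :=
  { χ | ∃ (G H : Finset I) (hG : G.Nonempty) (hH : H.Nonempty) (φ ψ : Form I),
      χ = ((Form.box G hG φ).and (Form.box H hH (φ.or ψ))).imp
            (Form.box (G ∪ H) (unionNE hG) φ) }

/-- The axioms of the base logic. -/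
def BaseAx (I : Type) [DecidableEq I] : Set (Form I) :=
  B1Ax I ∪ B2Ax I ∪ B3Ax I ∪ B4Ax I

/-- Hilbert-style provability from classical tautologies and the axioms in
`Ax`, closed under modus ponens and replacement of equivalents. -/
inductive Prv {I : Type} (Ax : Set (Form I)) : Form I → Prop
  | taut {φ : Form I} : Tautology φ → Prv Ax φ
  | ax {φ : Form I} : φ ∈ Ax → Prv Ax φ
  | mp {φ ψ : Form I} : Prv Ax (φ.imp ψ) → Prv Ax φ → Prv Ax ψ
  | re {φ ψ : Form I} (G : Finset I) (hG : G.Nonempty) :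
      Prv Ax (φ.iff ψ) → Prv Ax ((Form.box G hG φ).iff (Form.box G hG ψ))

/-- `Γ ⊢ φ` iff there are `ψ₁,…,ψₙ ∈ Γ` with `⊢ (ψ₁∧…∧ψₙ) → φ`. -/
def Deduces {I : Type} (Ax : Set (Form I)) (Γ : Set (Form I)) (φ : Form I) :
    Prop :=
  ∃ l : List (Form I), (∀ ψ ∈ l, ψ ∈ Γ) ∧
    Prv Ax ((l.foldr Form.and Form.top).imp φ)

/-- Semantic consequence over a class of models. -/
def SemConseq {I : Type} (C : NbhModel I → Prop) (Γ : Set (Form I))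
    (φ : Form I) : Prop :=
  ∀ M : NbhModel I, C M → ∀ w : M.W, (∀ ψ ∈ Γ, M.sat w ψ) → M.sat w φ

/-- Soundness and strong completeness of `Ax` w.r.t. the class `C`. -/
def SoundComplete {I : Type} (Ax : Set (Form I)) (C : NbhModel I → Prop) :
    Prop :=
  ∀ (Γ : Set (Form I)) (φ : Form I), Deduces Ax Γ φ ↔ SemConseq C Γ φ

section Soundness

variable {I : Type} {W : Type} {N : I → W → Set (Set W)} {V : ℕ → Set W} {w : W}

theorem satN_and {φ ψ : Form I} :
    satN N V (φ.and ψ) w ↔ satN N V φ w ∧ satN N V ψ w := by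
  simp only [Form.and, satN]; tauto

theorem satN_imp {φ ψ : Form I} :
    satN N V (φ.imp ψ) w ↔ (satN N V φ w → satN N V ψ w) := by
  simp only [Form.imp, satN]; tauto

theorem satN_top : satN N V (Form.top : Form I) w := by
  simp [Form.top, satN]

theorem satN_iff {φ ψ : Form I} :
    satN N V (φ.iff ψ) w ↔ (satN N V φ w ↔ satN N V ψ w) := by
  simp only [Form.iff, satN_and, satN_imp]; tauto

theorem evalP_satN (φ : Form I) :
    evalP (fun χ => satN N V χ w) φ ↔ satN N V φ w := by
  induction φ with
  | atom n => rfl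
  | bot => rfl
  | neg φ ih => simp only [evalP, satN, ih]
  | or φ ψ ih₁ ih₂ => simp only [evalP, satN, ih₁, ih₂]
  | box G hG φ => rfl

theorem satN_foldr_and {l : List (Form I)} :
    satN N V (l.foldr Form.and Form.top) w ↔ ∀ ψ ∈ l, satN N V ψ w := by
  induction l with
  | nil => simp [satN_top]
  | cons a l ih => simp [satN_and, ih]

/-- Replacing the witnesses outside `G` by those of another family. -/
theorem mem_ptwInter_union [DecidableEq I] {G H : Finset I} {Y Z : I → Set W}
    (hY : ∀ i ∈ G, Y i ∈ N i w) (hZ : ∀ i ∈ H, Z i ∈ N i w) :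
    ((⋂ i ∈ G, Y i) ∩ ⋂ i ∈ H \ G, Z i) ∈ ptwInter N (G ∪ H) w := by
  refine ⟨fun i => if i ∈ G then Y i else Z i, fun i hi => ?_, ?_⟩
  · by_cases h : i ∈ G
    · simpa [h] using hY i h
    · simpa [h] using hZ i ((Finset.mem_union.1 hi).resolve_left h)
  · ext x
    simp only [Set.mem_inter_iff, Set.mem_iInter, Finset.mem_sdiff, Finset.mem_union]
    constructor
    · rintro ⟨h₁, h₂⟩ i hi
      by_cases h : i ∈ G
      · simpa [h] using h₁ i h
      · simpa [h] using h₂ i ⟨hi.resolve_left h, h⟩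
    · intro h
      refine ⟨fun i hi => by simpa [hi] using h i (.inl hi), fun i hi => ?_⟩
      simpa [hi.2] using h i (.inr hi.1)

theorem ptwInter_union_of_subset [DecidableEq I] {G H : Finset I} {X X' : Set W}
    (hX : X ∈ ptwInter N G w) (hX' : X' ∈ ptwInter N H w) (h : X ⊆ X') :
    X ∈ ptwInter N (G ∪ H) w := by
  obtain ⟨Y, hY, rfl⟩ := hX
  obtain ⟨Z, hZ, rfl⟩ := hX'
  convert mem_ptwInter_union hY hZ using 1
  refine (Set.inter_eq_left.2 (h.trans fun x hx => ?_)).symm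
  simp only [Set.mem_iInter, Finset.mem_sdiff] at hx ⊢
  exact fun i hi => hx i hi.1

theorem satN_of_mem_baseAx [DecidableEq I] {χ : Form I} (h : χ ∈ BaseAx I) :
    satN N V χ w := by
  rcases h with ((h | h) | h) | h
  · obtain ⟨G, H, hG, hH, φ, ψ, hd, rfl⟩ := h
    rw [satN_imp, satN_and]
    rintro ⟨⟨Y, hY, hφ⟩, ⟨Z, hZ, hψ⟩⟩
    have := mem_ptwInter_union hY hZ
    rw [Finset.sdiff_eq_self_of_disjoint hd.symm, ← hφ, ← hψ] at this
    simp only [satN, satN_and]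
    exact this
  · obtain ⟨G, H, hG, hH, rfl⟩ := h
    rw [satN_imp]
    rintro ⟨Y, hY, hφ⟩
    simp only [satN_top, Set.ofPred_true] at hφ
    refine ⟨Y, fun i hi => hY i (Finset.mem_union_left _ hi), ?_⟩
    simp only [satN_top, Set.ofPred_true]
    symm
    simp only [Set.iInter_eq_univ]
    intro i hi
    have := hφ.symm
    simp only [Set.iInter_eq_univ] at this
    exact this i (Finset.mem_union_left _ hi)
  · obtain ⟨G, H, J, hG, hH, hJ, φ, rfl⟩ := h
    rw [satN_imp, satN_and]
    rintro ⟨hφ, ⟨Z, hZ, hψ⟩⟩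
    refine ptwInter_union_of_subset hφ
      ⟨Z, fun i hi => hZ i (by simp [hi]), rfl⟩ ?_
    rw [hψ]
    intro x hx
    simp only [Set.mem_iInter] at hx ⊢
    exact fun i hi => hx i (by simp [hi])
  · obtain ⟨G, H, hG, hH, φ, ψ, rfl⟩ := h
    rw [satN_imp, satN_and]
    rintro ⟨hφ, hψ⟩
    exact ptwInter_union_of_subset hφ hψ fun x hx => Or.inl hx

theorem satN_of_prv [DecidableEq I] {φ : Form I} (h : Prv (BaseAx I) φ) (w : W) :
    satN N V φ w := by
  induction h generalizing w with
  | taut h => exact (evalP_satN _).1 (h _)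
  | ax h => exact satN_of_mem_baseAx h
  | mp _ _ ih₁ ih₂ => exact satN_imp.1 (ih₁ w) (ih₂ w)
  | re G hG _ ih =>
    rw [satN_iff]
    simp only [satN, fun v => satN_iff.1 (ih v)]

end Soundness

section Compactness

variable {I : Type} {v : Form I → Prop} {φ ψ : Form I}

theorem evalP_and : evalP v (φ.and ψ) ↔ evalP v φ ∧ evalP v ψ := by
  simp only [Form.and, evalP]; tauto

theorem evalP_imp : evalP v (φ.imp ψ) ↔ (evalP v φ → evalP v ψ) := by
  simp only [Form.imp, evalP]; tauto

theorem evalP_top : evalP v (Form.top : Form I) := by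
  simp [Form.top, evalP]

theorem evalP_iff : evalP v (φ.iff ψ) ↔ (evalP v φ ↔ evalP v ψ) := by
  simp only [Form.iff, evalP_and, evalP_imp]; tauto

theorem evalP_foldr_and {l : List (Form I)} :
    evalP v (l.foldr Form.and Form.top) ↔ ∀ ψ ∈ l, evalP v ψ := by
  induction l with
  | nil => simp [evalP_top]
  | cons a l ih => simp [evalP_and, ih]

theorem isClopen_evalP (φ : Form I) :
    IsClopen {u : Form I → Bool | evalP (fun χ => u χ = true) φ} := by
  induction φ with
  | atom n =>
    exact (isClopen_discrete {true}).preimage (continuous_apply (Form.atom n : Form I))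
  | bot => exact isClopen_empty
  | neg φ ih => exact ih.compl
  | or φ ψ ih₁ ih₂ => exact ih₁.union ih₂
  | box G hG φ =>
    exact (isClopen_discrete {true}).preimage (continuous_apply (Form.box G hG φ))

/-- Compactness of propositional consequence. -/
theorem exists_finset_tautological_consequence {Δ : Set (Form I)}
    (h : ∀ v, (∀ ψ ∈ Δ, evalP v ψ) → evalP v φ) :
    ∃ t : Finset (Form I), (∀ ψ ∈ t, ψ ∈ Δ) ∧
      ∀ v, (∀ ψ ∈ t, evalP v ψ) → evalP v φ := by
  obtain ⟨t, ht⟩ := (isClopen_evalP φ).compl.isClosed.isCompact.elim_finite_subfamily_closed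
    (fun ψ : Δ => {u : Form I → Bool | evalP (fun χ => u χ = true) ψ.1})
    (fun ψ => (isClopen_evalP ψ.1).isClosed) (by
      ext u
      simp only [Set.mem_inter_iff, Set.mem_compl_iff, Set.mem_ofPred_eq, Set.mem_iInter,
        Set.mem_empty_iff_false, iff_false, not_and]
      exact fun hn hu => hn (h _ fun ψ hψ => hu ⟨ψ, hψ⟩))
  refine ⟨t.map (Function.Embedding.subtype _), by simp +contextual, fun v hv => ?_⟩
  by_contra hn
  have hv' : (fun χ => decide (v χ) = true) = v := by ext; simp
  have : (fun χ => decide (v χ)) ∈ (∅ : Set (Form I → Bool)) := by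
    rw [← ht]
    simp only [Set.mem_inter_iff, Set.mem_compl_iff, Set.mem_ofPred_eq, Set.mem_iInter, hv']
    exact ⟨hn, fun ψ hψ => hv _ (Finset.mem_map_of_mem _ hψ)⟩
  exact this

theorem prv_of_tautological_consequence {Ax : Set (Form I)} (l : List (Form I))
    (hl : ∀ ψ ∈ l, Prv Ax ψ) (h : ∀ v, (∀ ψ ∈ l, evalP v ψ) → evalP v φ) : Prv Ax φ := by
  induction l generalizing φ with
  | nil => exact .taut fun v => h v (by simp)
  | cons a l ih =>
    refine .mp (ih (fun ψ hψ => hl ψ (by simp [hψ])) fun v hv => ?_) (hl a (by simp))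
    exact evalP_imp.2 fun ha => h v (by simpa using ⟨ha, hv⟩)

/-- A valuation is coherent when it makes every theorem true; coherent valuations play the
role of maximal consistent sets. -/
def Coherent (Ax : Set (Form I)) (v : Form I → Prop) : Prop :=
  ∀ χ, Prv Ax χ → evalP v χ

theorem deduces_of_coherent {Ax Γ : Set (Form I)}
    (h : ∀ v, Coherent Ax v → (∀ ψ ∈ Γ, evalP v ψ) → evalP v φ) : Deduces Ax Γ φ := by
  obtain ⟨t, ht, htφ⟩ := exists_finset_tautological_consequence (Δ := Γ ∪ {χ | Prv Ax χ})
    (φ := φ) fun v hv => h v (fun χ hχ => hv χ (.inr hχ)) fun ψ hψ => hv ψ (.inl hψ)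
  refine ⟨(t.filter (· ∈ Γ)).toList, by simp, prv_of_tautological_consequence
    (t.filter (Prv Ax)).toList (by simp) fun v hv => ?_⟩
  rw [evalP_imp, evalP_foldr_and]
  refine fun hv' => htφ v fun ψ hψ => ?_
  rcases ht ψ hψ with hΓ | hp
  · exact hv' ψ (by simp [hψ, hΓ])
  · exact hv ψ (Finset.mem_toList.2 (Finset.mem_filter.2 ⟨hψ, hp⟩))

theorem prv_of_coherent {Ax : Set (Form I)} (h : ∀ v, Coherent Ax v → evalP v φ) :
    Prv Ax φ := by
  obtain ⟨l, hl, hp⟩ := deduces_of_coherent (Γ := ∅) fun v hv _ => h v hv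
  obtain rfl : l = [] := List.eq_nil_iff_forall_not_mem.2 hl
  exact hp.mp (.taut fun _ => evalP_top)

end Compactness

section BoxClosure

variable {I : Type}

/-- `v` makes `□_G φ` true (in particular `G` is nonempty). -/
def Boxed (v : Form I → Prop) (G : Finset I) (φ : Form I) : Prop :=
  ∃ hG : G.Nonempty, v (Form.box G hG φ)

variable [DecidableEq I] {v : Form I → Prop} {G G' H : Finset I} {φ ψ : Form I}

theorem Boxed.congr (hv : Coherent (BaseAx I) v) (h : Boxed v G φ)
    (e : ∀ u, Coherent (BaseAx I) u → (evalP u φ ↔ evalP u ψ)) : Boxed v G ψ := by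
  obtain ⟨hG, h⟩ := h
  have := hv _ (.re G hG (prv_of_coherent fun u hu => evalP_iff.2 (e u hu)))
  exact ⟨hG, (evalP_iff.1 this).1 h⟩

theorem Boxed.and (hv : Coherent (BaseAx I) v) (h₁ : Boxed v G φ) (h₂ : Boxed v H ψ)
    (hd : Disjoint G H) : Boxed v (G ∪ H) (φ.and ψ) := by
  obtain ⟨hG, h₁⟩ := h₁
  obtain ⟨hH, h₂⟩ := h₂
  have := hv _ (.ax (.inl (.inl (.inl ⟨G, H, hG, hH, φ, ψ, hd, rfl⟩))))
  exact ⟨_, evalP_imp.1 this (evalP_and.2 ⟨h₁, h₂⟩)⟩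

theorem Boxed.top_mono (hv : Coherent (BaseAx I) v) (h : Boxed v H Form.top)
    (hG : G.Nonempty) (hGH : G ⊆ H) : Boxed v G Form.top := by
  rw [← Finset.union_eq_right.2 hGH] at h
  obtain ⟨hH, h⟩ := h
  have := hv _ (.ax (.inl (.inl (.inr ⟨G, H, hG, hG.mono hGH, rfl⟩))))
  exact ⟨hG, evalP_imp.1 this h⟩

theorem Boxed.between (hv : Coherent (BaseAx I) v) (h₁ : Boxed v G φ) (h₂ : Boxed v H φ)
    (hG : G ⊆ G') (hH : G' ⊆ H) : Boxed v G' φ := by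
  have e₁ : G ∪ G' = G' := Finset.union_eq_right.2 hG
  have e₂ : G ∪ G' ∪ H = H := by rw [e₁, Finset.union_eq_right.2 hH]
  rw [← e₂] at h₂
  obtain ⟨nG, h₁⟩ := h₁
  obtain ⟨_, h₂⟩ := h₂
  have := hv _ (.ax (.inl (.inr ⟨G, G', H, nG, nG.mono hG, (nG.mono hG).mono hH, φ, rfl⟩)))
  rw [← e₁]
  exact ⟨_, evalP_imp.1 this (evalP_and.2 ⟨h₁, h₂⟩)⟩

theorem Boxed.union (hv : Coherent (BaseAx I) v) (h₁ : Boxed v G φ) (h₂ : Boxed v H ψ)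
    (e : ∀ u, Coherent (BaseAx I) u → evalP u φ → evalP u ψ) : Boxed v (G ∪ H) φ := by
  have h₂ : Boxed v H (φ.or ψ) := h₂.congr hv fun u hu => by
    have := e u hu
    simp only [evalP]
    tauto
  obtain ⟨hG, h₁⟩ := h₁
  obtain ⟨hH, h₂⟩ := h₂
  have := hv _ (.ax (.inr ⟨G, H, hG, hH, φ, ψ, rfl⟩))
  exact ⟨_, evalP_imp.1 this (evalP_and.2 ⟨h₁, h₂⟩)⟩

theorem boxed_biUnion_conj {ι : Type} (hv : Coherent (BaseAx I) v) (Q : Finset ι)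
    (g : ι → Finset I) (f : ι → Form I) (hQ : Q.Nonempty)
    (hB : ∀ q ∈ Q, Boxed v (g q) (f q)) (hd : (Q : Set ι).PairwiseDisjoint g) :
    ∃ φ, Boxed v (Q.biUnion g) φ ∧ ∀ u, evalP u φ ↔ ∀ q ∈ Q, evalP u (f q) := by
  induction hQ using Finset.Nonempty.cons_induction with
  | singleton a => exact ⟨f a, by simpa using hB a (by simp), by simp⟩
  | cons a s ha hs ih =>
    obtain ⟨φ, hφ, hev⟩ := ih (fun q hq => hB q (by simp [hq]))
      (hd.subset (by simp))
    refine ⟨(f a).and φ, ?_, fun u => by simp [evalP_and, hev]⟩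
    rw [Finset.cons_eq_insert, Finset.biUnion_insert]
    refine (hB a (by simp)).and hv hφ ?_
    rw [Finset.disjoint_biUnion_right]
    exact fun q hq => hd (by simp) (by simp [hq]) (by rintro rfl; exact ha hq)

theorem boxed_union_biUnion {ι : Type} (hv : Coherent (BaseAx I) v) (s : Finset ι)
    (g : ι → Finset I) (f : ι → Form I) (h : Boxed v G φ)
    (hB : ∀ q ∈ s, Boxed v (g q) (f q))
    (e : ∀ q ∈ s, ∀ u, Coherent (BaseAx I) u → evalP u φ → evalP u (f q)) :
    Boxed v (G ∪ s.biUnion g) φ := by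
  induction s using Finset.induction_on with
  | empty => simpa using h
  | insert a s _ ih =>
    rw [Finset.biUnion_insert, Finset.union_comm (g a), ← Finset.union_assoc]
    exact (ih (fun q hq => hB q (by simp [hq])) fun q hq => e q (by simp [hq])).union hv
      (hB a (by simp)) (e a (by simp))

theorem boxed_top_of_singletons (hv : Coherent (BaseAx I) v) (hG : G.Nonempty)
    (h : ∀ i ∈ G, Boxed v {i} Form.top) : Boxed v G Form.top := by
  obtain ⟨φ, hφ, hev⟩ := boxed_biUnion_conj hv G (fun i => {i}) (fun _ => Form.top) hG h
    (fun i _ j _ hij => by simpa using hij)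
  rw [Finset.biUnion_singleton_eq_self] at hφ
  exact hφ.congr hv fun u _ => by simp [hev, evalP_top]

end BoxClosure

section CanonicalModel

variable {I : Type}

/-- The data of a boxed formula: a nonempty group and the formula in the scope of the box. -/
abbrev BoxIndex (I : Type) : Type := {G : Finset I // G.Nonempty} × Form I

/-- Labels distinguishing the copies of a world of the canonical model: a choice of an element
from the group of every boxed formula. -/
abbrev Copy (I : Type) : Type := (q : BoxIndex I) → q.1.1

instance : Nonempty (Copy I) :=
  ⟨fun q => ⟨q.1.2.choose, q.1.2.choose_spec⟩⟩

/-- Worlds of the canonical model: coherent valuations paired with copy labels. -/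
abbrev CanWorld (Ax : Set (Form I)) : Type := {v : Form I → Prop // Coherent Ax v} × Copy I

/-- The neighbourhood contributed by the boxed formula `q` to the agent `i`. -/
def canSet (Ax : Set (Form I)) (q : BoxIndex I) (i : I) : Set (CanWorld Ax) :=
  {x | evalP x.1.1 q.2 ∨ (x.2 q : I) ≠ i}

/-- Neighbourhood functions of the canonical model. -/
def canN (Ax : Set (Form I)) (i : I) (x : CanWorld Ax) : Set (Set (CanWorld Ax)) :=
  {X | ∃ q : BoxIndex I, i ∈ q.1.1 ∧ x.1.1 (Form.box q.1.1 q.1.2 q.2) ∧ X = canSet Ax q i}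

theorem mem_ptwInter_canN {Ax : Set (Form I)} {G : Finset I} {hG : G.Nonempty} {φ : Form I}
    {x : CanWorld Ax} (h : x.1.1 (Form.box G hG φ)) :
    {y : CanWorld Ax | evalP y.1.1 φ} ∈ ptwInter (canN Ax) G x := by
  refine ⟨canSet Ax (⟨G, hG⟩, φ), fun i hi => ⟨(⟨G, hG⟩, φ), hi, h, rfl⟩, ?_⟩
  ext y
  simp only [canSet, Set.mem_iInter, Set.mem_ofPred_eq]
  exact ⟨fun hy _ _ => .inl hy,
    fun hy => (hy _ (y.2 (⟨G, hG⟩, φ)).2).resolve_right fun hn => hn rfl⟩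

variable [DecidableEq I]

theorem boxed_of_mem_ptwInter_canN {G : Finset I} (hG : G.Nonempty) {φ : Form I}
    {x : CanWorld (BaseAx I)}
    (h : {y : CanWorld (BaseAx I) | evalP y.1.1 φ} ∈ ptwInter (canN (BaseAx I)) G x) :
    Boxed x.1.1 G φ := by
  obtain ⟨Y, hY, hφ⟩ := h
  have hv := x.1.2
  have : ∀ i : I, ∃ q : BoxIndex I, i ∈ G →
      i ∈ q.1.1 ∧ Boxed x.1.1 q.1.1 q.2 ∧ Y i = canSet (BaseAx I) q i := fun i => by
    by_cases hi : i ∈ G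
    · obtain ⟨q, h₁, h₂, h₃⟩ := hY i hi
      exact ⟨q, fun _ => ⟨h₁, ⟨_, h₂⟩, h₃⟩⟩
    · exact ⟨(⟨G, hG⟩, φ), fun h => absurd h hi⟩
  choose p hp using this
  have key : ∀ v, Coherent (BaseAx I) v → ∀ k : Copy I,
      (evalP v φ ↔ ∀ i ∈ G, evalP v (p i).2 ∨ (k (p i) : I) ≠ i) := fun v hv k => by
    have := Set.ext_iff.1 hφ (⟨v, hv⟩, k)
    simp only [Set.mem_ofPred_eq, Set.mem_iInter] at this
    rw [this]
    refine forall₂_congr fun i hi => ?_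
    rw [(hp i hi).2.2]
    rfl
  obtain ⟨k₀⟩ := (inferInstance : Nonempty (Copy I))
  have fwd : ∀ i ∈ G, ∀ v, Coherent (BaseAx I) v → evalP v φ → evalP v (p i).2 := by
    intro i hi v hv hvφ
    refine ((key v hv (Function.update k₀ (p i) ⟨i, (hp i hi).1⟩)).1 hvφ i hi).resolve_right ?_
    simp
  let Q : Finset (BoxIndex I) := (G.image p).filter fun q => ∀ i ∈ q.1.1, i ∈ G ∧ p i = q
  have bwd : ∀ v, Coherent (BaseAx I) v → (∀ q ∈ Q, evalP v q.2) → evalP v φ := by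
    intro v hv hq
    refine (key v hv fun q => if h : ∃ i : q.1.1, ¬ (i.1 ∈ G ∧ p i = q) then h.choose
      else k₀ q).2 fun i hi => ?_
    by_cases h : ∃ j : (p i).1.1, ¬ (j.1 ∈ G ∧ p j = p i)
    · right
      rw [dif_pos h]
      intro hj
      have := h.choose_spec
      rw [hj] at this
      exact this ⟨hi, rfl⟩
    · left
      push Not at h
      exact hq _ (Finset.mem_filter.2
        ⟨Finset.mem_image_of_mem p hi, fun j hj => h ⟨j, hj⟩⟩)
  rcases Q.eq_empty_or_nonempty with hQ | hQ
  · have hφ : ∀ v, Coherent (BaseAx I) v → evalP v φ := fun v hv => bwd v hv (by simp [hQ])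
    refine (boxed_top_of_singletons hv hG fun i hi => ?_).congr hv
      fun u hu => iff_of_true evalP_top (hφ u hu)
    exact ((hp i hi).2.1.congr hv fun u hu =>
      iff_of_true (fwd i hi u hu (hφ u hu)) evalP_top).top_mono hv (by simp)
        (by simpa using (hp i hi).1)
  · have hQG : ∀ q ∈ Q, ∀ i ∈ q.1.1, i ∈ G ∧ p i = q := fun q hq => (Finset.mem_filter.1 hq).2
    obtain ⟨ψ, hψ, hev⟩ := boxed_biUnion_conj hv Q (fun q => q.1.1) (fun q => q.2) hQ
      (fun q hq => by
        obtain ⟨i, hi, rfl⟩ := Finset.mem_image.1 (Finset.mem_filter.1 hq).1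
        exact (hp i hi).2.1)
      (fun q hq r hr hqr => Finset.disjoint_left.2 fun i hiq hir =>
        hqr ((hQG q hq i hiq).2.symm.trans (hQG r hr i hir).2))
    have hB : Boxed x.1.1 (Q.biUnion fun q => q.1.1) φ := hψ.congr hv fun u hu => by
      rw [hev]
      refine ⟨bwd u hu, fun hφ q hq => ?_⟩
      obtain ⟨i, hi, rfl⟩ := Finset.mem_image.1 (Finset.mem_filter.1 hq).1
      exact fwd i hi u hu hφ
    refine hB.between hv (boxed_union_biUnion hv G (fun i => (p i).1.1) (fun i => (p i).2) hB
      (fun i hi => (hp i hi).2.1) fwd) ?_ ?_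
    · exact Finset.biUnion_subset.2 fun q hq i hi => (hQG q hq i hi).1
    · exact fun i hi => Finset.mem_union_right _ (Finset.mem_biUnion.2 ⟨i, hi, (hp i hi).1⟩)

theorem truth_lemma (φ : Form I) (x : CanWorld (BaseAx I)) :
    satN (canN (BaseAx I)) (fun n => {y | y.1.1 (Form.atom n)}) φ x ↔ evalP x.1.1 φ := by
  induction φ generalizing x with
  | atom n => rfl
  | bot => rfl
  | neg φ ih => simp only [satN, evalP, ih]
  | or φ ψ ih₁ ih₂ => simp only [satN, evalP, ih₁, ih₂]
  | box G hG φ ih =>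
    simp only [satN, evalP, ih]
    exact ⟨fun h => (boxed_of_mem_ptwInter_canN hG h).2, mem_ptwInter_canN⟩

end CanonicalModel

/-- The base logic is sound and strongly complete w.r.t. the
class of all neighbourhood models with pointwise intersection. -/
theorem base_sound_complete (I : Type) [DecidableEq I] :
    SoundComplete (BaseAx I) (fun _ : NbhModel I => True) := by
  intro Γ φ
  constructor
  · rintro ⟨l, hl, hp⟩ M _ w hw
    exact satN_imp.1 (satN_of_prv hp w) (satN_foldr_and.2 fun ψ hψ => hw ψ (hl ψ hψ))
  · intro h
    refine deduces_of_coherent fun v hv hΓ => ?_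
    obtain ⟨k⟩ := (inferInstance : Nonempty (Copy I))
    let M : NbhModel I :=
      { W := CanWorld (BaseAx I)
        ne := ⟨⟨v, hv⟩, k⟩
        N := canN (BaseAx I)
        V := fun n => {y | y.1.1 (Form.atom n)} }
    exact (truth_lemma φ (⟨v, hv⟩, k)).1
      (h M trivial (⟨v, hv⟩, k) fun ψ hψ => (truth_lemma ψ _).2 (hΓ ψ hψ))
end

section
/- Let 𝒴 be a set of sets of the form X^{G,ψ}_i (with i ∈ G and (G,ψ) ∈ 𝔾 × 𝔏) such that for no pair (G,φ) does 𝒴 contain the whole family {X^{G,φ}_i : i ∈ G}. Then there exists f₀ ∈ 𝔽 such that {(Λ,f₀) : (Λ,f₀) ∈ W^c} ⊆ ⋂𝒴. -/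
attribute [local instance] Classical.propDecidable

/-- A set of formulas is consistent iff it does not derive ⊥. -/
def ConsistentSet {I : Type} (Ax : Set (Form I)) (Γ : Set (Form I)) : Prop :=
  ¬ Deduces Ax Γ Form.bot

/-- Maximal consistent sets. -/
def MCS {I : Type} (Ax : Set (Form I)) (Λ : Set (Form I)) : Prop :=
  ConsistentSet Ax Λ ∧ ∀ φ ∉ Λ, ¬ ConsistentSet Ax (insert φ Λ)

/-- 𝔾: the finite nonempty subsets of I. -/
def GG (I : Type) := { G : Finset I // G.Nonempty }

/-- 𝔽: the functions f : 𝔾 × 𝔏 → I with f(G,φ) ∈ G. -/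
def FF (I : Type) := { f : GG I × Form I → I // ∀ p : GG I × Form I, f p ∈ p.1.1 }

/-- W^c: the canonical worlds (Λ,f) with Λ an MCS of the base logic and f ∈ 𝔽. -/
def Wc (I : Type) [DecidableEq I] := { p : Set (Form I) × FF I // MCS (BaseAx I) p.1 }

/-- The sets X^{G,φ}_i = {(Λ,f) ∈ W^c : φ ∈ Λ or f(G,φ) ≠ i}. -/
def Xset {I : Type} [DecidableEq I] (G : GG I) (φ : Form I) (i : I) :
    Set (Wc I) :=
  { w | φ ∈ w.1.1 ∨ (w.1.2).1 (G, φ) ≠ i }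

/-- The canonical neighbourhood functions N^c_i. -/
def Nc {I : Type} [DecidableEq I] (i : I) (w : Wc I) : Set (Set (Wc I)) :=
  { X | ∃ (G : GG I) (φ : Form I),
      Form.box G.1 G.2 φ ∈ w.1.1 ∧ i ∈ G.1 ∧ X = Xset G φ i }

/-- The canonical valuation V^c. -/
def Vc {I : Type} [DecidableEq I] (n : ℕ) : Set (Wc I) :=
  { w | Form.atom n ∈ w.1.1 }

/-- If 𝒴 consists of sets of the form X^{G,ψ}_i (i ∈ G) and for
no (G,φ) does 𝒴 contain the whole family {X^{G,φ}_i : i ∈ G}, then there is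
f₀ ∈ 𝔽 with {(Λ,f₀) ∈ W^c} ⊆ ⋂𝒴. -/
theorem aux_lemma_one (I : Type) [DecidableEq I] (Y : Set (Set (Wc I)))
    (hform : ∀ X ∈ Y, ∃ (G : GG I) (ψ : Form I) (i : I), i ∈ G.1 ∧ X = Xset G ψ i)
    (hno : ∀ (G : GG I) (φ : Form I), ¬ ({ X | ∃ i ∈ G.1, X = Xset G φ i } ⊆ Y)) :
    ∃ f₀ : FF I, { w : Wc I | w.1.2 = f₀ } ⊆ ⋂₀ Y := by
  have hmiss : ∀ p : GG I × Form I, ∃ i ∈ p.1.1, Xset p.1 p.2 i ∉ Y := by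
    intro p
    obtain ⟨_, ⟨i, hi, rfl⟩, hX⟩ := Set.not_subset.mp (hno p.1 p.2)
    exact ⟨i, hi, hX⟩
  choose f hfG hfY using hmiss
  refine ⟨⟨f, hfG⟩, ?_⟩
  intro w hw X hX
  obtain ⟨G, ψ, i, -, rfl⟩ := hform X hX
  refine Or.inr ?_
  rw [show w.1.2 = ⟨f, hfG⟩ from hw]
  rintro rfl
  exact hfY (G, ψ) hX
end
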